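/- Assume ν-almost surely |F(p)| ≤ K and O ⊆ F(p), assume r-Regular Facts (for every y ∈ U, ν({p : y ∈ F(p)}) ≤ r · 𝔼_ν[|F(p) ∩ U|]/|U|, with r ≥ 1), and suppose U is nonempty. Let Π be a measurable assignment p ↦ Π(p) of a partition of Ω to each distribution p. Then ν({p : g(H(p)) ≥ p(U)/(K+1)² − ‖g − p^{Π(p)}‖_TV/(K+1)}) ≥ 1 − rK/|U|. (Missing-mass high-confidence bound under r-Regular Facts.) -/

import Mathlib

open MeasureTheory

/-- Total variation distance on a finite type: `max_{S ⊆ Ω} |g(S) − h(S)|`. -/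
noncomputable def tvDist {Ω : Type*} [Fintype Ω] [DecidableEq Ω] (g h : Ω → ℝ) : ℝ :=
  Finset.univ.sup' ⟨∅, Finset.mem_univ ∅⟩
    (fun S : Finset Ω => |∑ y ∈ S, g y - ∑ y ∈ S, h y|)

lemma coarse_bound {Ω : Type*} [Fintype Ω] [DecidableEq Ω] (O : Finset Ω) (K : ℕ)
    (hOK : O.card ≤ K) (p : Ω → ℝ) (hp : ∀ y, 0 ≤ p y) (B : Ω → Finset Ω)
    (hmem : ∀ y, y ∈ B y) (hcell : ∀ y z, z ∈ B y → B z = B y) :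
    (∑ y ∈ Oᶜ, p y) / ((K : ℝ) + 1) ≤ ∑ y ∈ Oᶜ, (∑ z ∈ B y, p z) / (B y).card := by
  have hK : (0 : ℝ) < (K : ℝ) + 1 := by positivity
  have h1 : ∀ z ∈ Oᶜ, p z / ((K : ℝ) + 1) ≤
      ∑ y ∈ Oᶜ, if z ∈ B y then p z / (B y).card else 0 := by
    intro z hz
    have e : ∀ y ∈ Oᶜ, (if z ∈ B y then p z / ((B y).card : ℝ) else 0)
        = if y ∈ B z then p z / ((B z).card : ℝ) else 0 := by
      intro y _
      by_cases h : z ∈ B y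
      · have h2 := hcell y z h
        have h3 : y ∈ B z := by rw [h2]; exact hmem y
        rw [if_pos h, if_pos h3, h2]
      · have h3 : y ∉ B z := by
          intro h3
          apply h
          rw [hcell z y h3]
          exact hmem z
        rw [if_neg h, if_neg h3]
    rw [Finset.sum_congr rfl e, ← Finset.sum_filter, Finset.sum_const, nsmul_eq_mul]
    set V := Oᶜ.filter (fun y => y ∈ B z) with hV
    have hV1 : 1 ≤ V.card := Finset.card_pos.mpr ⟨z, by simp [hV, hmem]; simpa using hz⟩
    have hsub : B z ⊆ V ∪ O := by
      intro y hy
      by_cases h : y ∈ O <;> simp [hV, hy, h]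
    have hc : (B z).card ≤ V.card + K :=
      (Finset.card_le_card hsub).trans ((Finset.card_union_le _ _).trans (by omega))
    have hB : 0 < (B z).card := Finset.card_pos.mpr ⟨z, hmem z⟩
    have hB' : (0 : ℝ) < (B z).card := by exact_mod_cast hB
    have hc' : ((B z).card : ℝ) ≤ V.card * ((K : ℝ) + 1) := by
      have : (B z).card ≤ V.card * (K + 1) := by nlinarith
      exact_mod_cast this
    rw [← mul_div_assoc, div_le_div_iff₀ hK hB']
    nlinarith [mul_le_mul_of_nonneg_left hc' (hp z)]
  rw [Finset.sum_div]
  refine (Finset.sum_le_sum h1).trans ?_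
  rw [Finset.sum_comm]
  refine Finset.sum_le_sum fun y _ => ?_
  rw [← Finset.sum_filter, ← Finset.sum_div]
  refine div_le_div_of_nonneg_right ?_ (Nat.cast_nonneg _)
  refine Finset.sum_le_sum_of_subset_of_nonneg ?_ fun _ _ _ => hp _
  intro z hz
  exact (Finset.mem_filter.mp hz).2

/-- **Missing-mass high-confidence bound under `r`-Regular Facts.**
`ν` is a Borel probability measure on the simplex `Δ(Ω)` of probability
distributions on the finite nonempty set `Ω`; for `p ∈ Δ(Ω)`,
`F(p) := {y : p(y) > 0}` and `H(p) := Ω \ F(p)`.  Assume ν-a.s. `|F(p)| ≤ K`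
and `O ⊆ F(p)`, `r`-Regular Facts (for every `y ∈ U := Oᶜ`,
`ν({p : y ∈ F(p)}) ≤ r·𝔼_ν[|F(p) ∩ U|]/|U|`, `r ≥ 1`), and `U` nonempty.  `Π`
is a measurable assignment of a partition (given by its cell map) to each `p`.
Then:
`ν({p : g(H(p)) ≥ p(U)/(K+1)² − ‖g − p^{Π(p)}‖_TV/(K+1)}) ≥ 1 − rK/|U|`. -/
theorem missing_mass_high_confidence_bound_r_regular
    {Ω : Type*} [Fintype Ω] [DecidableEq Ω] [Nonempty Ω]
    [MeasurableSpace (Finset Ω)] [MeasurableSingletonClass (Finset Ω)]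
    (O : Finset Ω) (hU : (Oᶜ : Finset Ω).Nonempty)
    (ν : Measure {p : Ω → ℝ // (∀ y, 0 ≤ p y) ∧ ∑ y, p y = 1})
    [IsProbabilityMeasure ν]
    (K : ℕ) (hK : 0 < K) (r : ℝ) (hr : 1 ≤ r)
    (hsparse : ∀ᵐ p ∂ν, (Finset.univ.filter fun y => 0 < p.1 y).card ≤ K)
    (hO : ∀ᵐ p ∂ν, ∀ y ∈ O, 0 < p.1 y)
    (hreg : ∀ y ∈ (Oᶜ : Finset Ω),
      (ν {p | 0 < p.1 y}).toReal ≤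
        r * (∫ p, (((Finset.univ.filter fun y => 0 < p.1 y) ∩ Oᶜ).card : ℝ) ∂ν)
          / (Oᶜ : Finset Ω).card)
    (part : {p : Ω → ℝ // (∀ y, 0 ≤ p y) ∧ ∑ y, p y = 1} → Ω → Finset Ω)
    (hmem : ∀ p y, y ∈ part p y)
    (hcell : ∀ p y z, z ∈ part p y → part p z = part p y)
    (hmeas : Measurable part)
    (g : Ω → ℝ) (hg0 : ∀ y, 0 ≤ g y) (hg1 : ∑ y, g y = 1) :
    (1 : ℝ) - r * K / (Oᶜ : Finset Ω).card ≤
      (ν {p | (∑ y ∈ Oᶜ, p.1 y) / ((K : ℝ) + 1) ^ 2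
          - tvDist g (fun y => (∑ z ∈ part p y, p.1 z) / (part p y).card)
            / ((K : ℝ) + 1)
        ≤ ∑ y ∈ (Finset.univ.filter fun y => 0 < p.1 y)ᶜ, g y}).toReal := by
  obtain ⟨y0, hy0, hmax⟩ := Finset.exists_max_image Oᶜ g hU
  set A := {p : {p : Ω → ℝ // (∀ y, 0 ≤ p y) ∧ ∑ y, p y = 1} | 0 < p.1 y0} with hA
  have hUc : (0 : ℝ) < (Oᶜ : Finset Ω).card := by exact_mod_cast hU.card_pos
  have hint : ∫ p, (((Finset.univ.filter fun y => 0 < p.1 y) ∩ Oᶜ).card : ℝ) ∂ν ≤ K := by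
    have := integral_mono_of_nonneg (μ := ν)
      (f := fun p => (((Finset.univ.filter fun y => 0 < p.1 y) ∩ Oᶜ).card : ℝ))
      (g := fun _ => (K : ℝ)) (Filter.Eventually.of_forall fun p => by positivity)
      (integrable_const _) (by
        filter_upwards [hsparse] with p hp
        exact_mod_cast (Finset.card_le_card Finset.inter_subset_left).trans hp)
    simpa using this
  have hνA : (ν A).toReal ≤ r * K / (Oᶜ : Finset Ω).card := by
    refine (hreg y0 hy0).trans ?_
    gcongr
  set G := {p : {p : Ω → ℝ // (∀ y, 0 ≤ p y) ∧ ∑ y, p y = 1} |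
        (∑ y ∈ Oᶜ, p.1 y) / ((K : ℝ) + 1) ^ 2
          - tvDist g (fun y => (∑ z ∈ part p y, p.1 z) / (part p y).card)
            / ((K : ℝ) + 1)
        ≤ ∑ y ∈ (Finset.univ.filter fun y => 0 < p.1 y)ᶜ, g y} with hG
  have hcov : ∀ᵐ p ∂ν, p ∈ G ∪ A := by
    filter_upwards [hsparse, hO] with p hpK hpO
    by_cases hpA : 0 < p.1 y0
    · exact Or.inr hpA
    left
    set F := Finset.univ.filter fun y => 0 < p.1 y with hF
    have hOF : O ⊆ F := fun y hy => by simp [hF, hpO y hy]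
    have hcb := coarse_bound O K ((Finset.card_le_card hOF).trans hpK) p.1 p.2.1 (part p)
      (hmem p) (hcell p)
    have htv : |∑ y ∈ Oᶜ, g y - ∑ y ∈ Oᶜ, (∑ z ∈ part p y, p.1 z) / ((part p y).card : ℝ)| ≤
        tvDist g (fun y => (∑ z ∈ part p y, p.1 z) / (part p y).card) :=
      Finset.le_sup' (fun S : Finset Ω =>
        |∑ y ∈ S, g y - ∑ y ∈ S, (∑ z ∈ part p y, p.1 z) / ((part p y).card : ℝ)|)
        (Finset.mem_univ Oᶜ)
    have hy0F : y0 ∈ Fᶜ := by simp [hF]; exact not_lt.mp hpA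
    have hm : g y0 ≤ ∑ y ∈ Fᶜ, g y := Finset.single_le_sum (fun y _ => hg0 y) hy0F
    have hsplit : ∑ y ∈ Oᶜ, g y ≤ ∑ y ∈ F ∩ Oᶜ, g y + ∑ y ∈ Fᶜ, g y := by
      rw [← Finset.sum_union (Finset.disjoint_left.mpr fun y h1 h2 => by
        simp only [Finset.mem_inter, Finset.mem_compl] at h1 h2; exact h2 h1.1)]
      refine Finset.sum_le_sum_of_subset_of_nonneg ?_ fun y _ _ => hg0 y
      intro y hy
      by_cases h : y ∈ F
      · exact Finset.mem_union_left _ (Finset.mem_inter.mpr ⟨h, hy⟩)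
      · exact Finset.mem_union_right _ (Finset.mem_compl.mpr h)
    have hFU : ∑ y ∈ F ∩ Oᶜ, g y ≤ K * g y0 := by
      have h1 := Finset.sum_le_card_nsmul (F ∩ Oᶜ) g (g y0)
        fun y hy => hmax y (Finset.mem_inter.mp hy).2
      rw [nsmul_eq_mul] at h1
      refine h1.trans (mul_le_mul_of_nonneg_right ?_ (hg0 y0))
      exact_mod_cast (Finset.card_le_card Finset.inter_subset_left).trans hpK
    have hK1 : (0 : ℝ) < (K : ℝ) + 1 := by positivity
    have hKm : (K : ℝ) * g y0 ≤ K * ∑ y ∈ Fᶜ, g y :=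
      mul_le_mul_of_nonneg_left hm (by positivity)
    have habs := (abs_le.mp htv).1
    change _ / _ - _ / _ ≤ ∑ y ∈ Fᶜ, g y
    rw [pow_two, ← div_div, ← sub_div, div_le_iff₀ hK1]
    linarith
  have h1 : (1 : ENNReal) ≤ ν G + ν A := by
    have : ν (G ∪ A) = 1 := by
      rw [← measure_univ (μ := ν)]
      exact measure_congr (Filter.eventuallyEq_univ.mpr hcov)
    rw [← this]
    exact measure_union_le _ _
  have h2 : (1 : ℝ) ≤ (ν G).toReal + (ν A).toReal := by
    rw [← ENNReal.toReal_add (measure_ne_top _ _) (measure_ne_top _ _)]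
    have := ENNReal.toReal_mono (by finiteness) h1
    simpa using this
  linarith
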